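/- arXiv:1909.06430 — 3 statements merged into one kernel-verified Lean document; each statement's English description precedes it below -/
import Mathlib

section
/- Fix a prime power q and an integer s ≥ 2. The function g(β) = E_{w∼μ_q(β)^s}[wt(w) | w_1 + ⋯ + w_s = 0] is strictly increasing on the interval (0, (q−1)/q]; moreover g(β) → 0 as β → 0⁺ and g((q−1)/q) = (q−1)/q. -/
open Finset

/-- The distribution `μ_q(β)` on a finite field `F` of size `q`: probability `1-β` on `0`
and `β/(q-1)` on each nonzero element. -/
noncomputable def muDist {F : Type} [DecidableEq F] [Zero F] (q : ℕ) (β : ℝ) (a : F) : ℝ :=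
  if a = 0 then 1 - β else β / (q - 1)

/-- `E_{w∼μ_q(β)^s}[wt(w) | w_1 + ⋯ + w_s = 0]`: the conditional expectation of the
relative Hamming weight of `s` i.i.d. samples from `μ_q(β)` given that they sum to zero. -/
noncomputable def condWt (F : Type) [Field F] [Fintype F] [DecidableEq F]
    (q s : ℕ) (β : ℝ) : ℝ :=
  (∑ w ∈ Finset.univ.filter (fun w : Fin s → F => ∑ i, w i = 0),
      (∏ i, muDist q β (w i)) *
        (((Finset.univ.filter fun i : Fin s => w i ≠ 0).card : ℝ) / s)) /
  ∑ w ∈ Finset.univ.filter (fun w : Fin s → F => ∑ i, w i = 0), ∏ i, muDist q β (w i)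

/-- The mean of `k` on `W` when `x ∈ W` is given weight proportional to `t ^ k x`. -/
noncomputable def tiltedMean {ι : Type*} (W : Finset ι) (k : ι → ℕ) (t : ℝ) : ℝ :=
  (∑ x ∈ W, t ^ k x * k x) / ∑ x ∈ W, t ^ k x

lemma sub_mul_pow_mul_pow_sub_pos {t u : ℝ} (ht : 0 < t) (htu : t < u) {m n : ℕ} (hmn : m ≠ n) :
    0 < ((m : ℝ) - n) * (u ^ m * t ^ n - u ^ n * t ^ m) := by
  wlog h : n < m generalizing m n
  · have := this hmn.symm (by omega)
    linarith
  obtain ⟨d, rfl⟩ := Nat.exists_eq_add_of_lt h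
  have hpow : t ^ (d + 1) < u ^ (d + 1) := pow_lt_pow_left₀ htu ht.le (by omega)
  have hu : 0 < u := ht.trans htu
  have heq : u ^ (n + d + 1) * t ^ n - u ^ n * t ^ (n + d + 1)
      = u ^ n * t ^ n * (u ^ (d + 1) - t ^ (d + 1)) := by ring
  rw [heq]
  have hdiff : (0 : ℝ) < ((n + d + 1 : ℕ) : ℝ) - n := by push_cast; linarith [d.cast_nonneg (α := ℝ)]
  have := sub_pos.2 hpow
  positivity

lemma tiltedMean_strictMonoOn {ι : Type*} {W : Finset ι} {k : ι → ℕ} {a b : ι}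
    (ha : a ∈ W) (hb : b ∈ W) (hab : k a ≠ k b) :
    StrictMonoOn (tiltedMean W k) (Set.Ioi 0) := by
  intro t ht u hu htu
  rw [Set.mem_Ioi] at ht hu
  have hpos : ∀ r : ℝ, 0 < r → 0 < ∑ x ∈ W, r ^ k x := fun r hr =>
    sum_pos (fun x _ => pow_pos hr _) ⟨a, ha⟩
  rw [tiltedMean, tiltedMean, div_lt_div_iff₀ (hpos t ht) (hpos u hu)]
  have hsum : 0 < ∑ x ∈ W, ∑ y ∈ W,
      ((k x : ℝ) - k y) * (u ^ k x * t ^ k y - u ^ k y * t ^ k x) := by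
    have hnonneg : ∀ x y, 0 ≤ ((k x : ℝ) - k y) * (u ^ k x * t ^ k y - u ^ k y * t ^ k x) := by
      intro x y
      by_cases h : k x = k y
      · simp [h]
      · exact (sub_mul_pow_mul_pow_sub_pos ht htu h).le
    exact sum_pos' (fun x _ => sum_nonneg fun y _ => hnonneg x y)
      ⟨a, ha, sum_pos' (fun y _ => hnonneg a y) ⟨b, hb, sub_mul_pow_mul_pow_sub_pos ht htu hab⟩⟩
  have hexpand : ∑ x ∈ W, ∑ y ∈ W,
      ((k x : ℝ) - k y) * (u ^ k x * t ^ k y - u ^ k y * t ^ k x)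
      = 2 * ((∑ x ∈ W, u ^ k x * k x) * (∑ y ∈ W, t ^ k y)
        - (∑ x ∈ W, t ^ k x * k x) * ∑ y ∈ W, u ^ k y) := by
    have hterm : ∀ x y, ((k x : ℝ) - k y) * (u ^ k x * t ^ k y - u ^ k y * t ^ k x)
        = (u ^ k x * k x) * t ^ k y - (t ^ k x * k x) * u ^ k y
          + (t ^ k x * (u ^ k y * k y) - u ^ k x * (t ^ k y * k y)) := by
      intro x y; ring
    simp only [hterm, sum_add_distrib, sum_sub_distrib, ← mul_sum, ← sum_mul]
    ring
  linarith

lemma tiltedMean_zero {ι : Type*} (W : Finset ι) (k : ι → ℕ) : tiltedMean W k 0 = 0 := by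
  rw [tiltedMean, sum_eq_zero, zero_div]
  intro x _
  rcases Nat.eq_zero_or_pos (k x) with h | h
  · simp [h]
  · simp [h.ne']

lemma continuousAt_tiltedMean_zero {ι : Type*} {W : Finset ι} {k : ι → ℕ} {a : ι}
    (ha : a ∈ W) (hka : k a = 0) : ContinuousAt (tiltedMean W k) 0 := by
  have hpos : 0 < ∑ x ∈ W, (0 : ℝ) ^ k x :=
    sum_pos' (fun x _ => pow_nonneg le_rfl _) ⟨a, ha, by simp [hka]⟩
  unfold tiltedMean
  exact ContinuousAt.div (by fun_prop) (by fun_prop) hpos.ne'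

section ZeroSum

variable {F : Type} [Field F] [DecidableEq F] {s : ℕ}

lemma prod_muDist (q : ℕ) {β : ℝ} (hβ : β ≠ 1) (w : Fin s → F) :
    ∏ i, muDist q β (w i) = (1 - β) ^ s * (β / (q - 1) / (1 - β)) ^ hammingNorm w := by
  have h1 : 1 - β ≠ 0 := sub_ne_zero.2 hβ.symm
  have hfactor : ∀ i, muDist q β (w i)
      = (1 - β) * if w i ≠ 0 then β / (q - 1) / (1 - β) else 1 := by
    intro i
    by_cases h : w i = 0
    · simp [muDist, h]
    · simp only [muDist, h, if_false, ne_eq, not_false_eq_true, if_true]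
      field_simp
  simp only [hfactor, prod_mul_distrib, prod_const, card_univ, Fintype.card_fin, prod_ite]
  simp [hammingNorm]

lemma condWt_eq_tiltedMean [Fintype F] (q : ℕ) {β : ℝ} (hβ : β ≠ 1) :
    condWt F q s β = tiltedMean (univ.filter fun w : Fin s → F => ∑ i, w i = 0) hammingNorm
      (β / (q - 1) / (1 - β)) / s := by
  have h1 : (1 - β) ^ s ≠ 0 := pow_ne_zero _ (sub_ne_zero.2 hβ.symm)
  have hcard : ∀ w : Fin s → F, #{i | w i ≠ 0} = hammingNorm w := fun _ => rfl
  simp only [condWt, tiltedMean, prod_muDist q hβ, hcard, mul_assoc, ← mul_sum]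
  rw [mul_div_mul_left _ _ h1]
  simp only [← mul_div_assoc, ← sum_div]
  exact div_right_comm _ _ _

lemma card_zeroSum_coord_eq [Fintype F] {i j : Fin s} (hij : i ≠ j) (a : F) :
    #{w : Fin s → F | ∑ l, w l = 0 ∧ w i = a} = #{w : Fin s → F | ∑ l, w l = 0 ∧ w i = 0} := by
  refine card_equiv (Equiv.subRight (Pi.single i a - Pi.single j a)) fun w => ?_
  simp [sum_sub_distrib, hij, sub_eq_zero]

lemma card_mul_card_zeroSum_coord [Fintype F] {i j : Fin s} (hij : i ≠ j) :
    Fintype.card F * #{w : Fin s → F | ∑ l, w l = 0 ∧ w i = 0}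
      = #{w : Fin s → F | ∑ l, w l = 0} := by
  rw [card_eq_sum_card_fiberwise (s := {w : Fin s → F | ∑ l, w l = 0}) (f := fun w => w i)
    (t := univ) (fun _ _ => mem_coe.2 (mem_univ _))]
  simp [filter_filter, card_zeroSum_coord_eq hij]

lemma card_mul_sum_hammingNorm_zeroSum [Fintype F] (hs : 2 ≤ s) :
    (Fintype.card F : ℝ) * ∑ w : Fin s → F with ∑ l, w l = 0, (hammingNorm w : ℝ)
      = s * ((Fintype.card F - 1) * #{w : Fin s → F | ∑ l, w l = 0}) := by
  have : Nontrivial (Fin s) := Fin.nontrivial_iff_two_le.2 hs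
  have hnorm : ∀ w : Fin s → F, (hammingNorm w : ℝ) = ∑ i, (1 - if w i = 0 then (1 : ℝ) else 0) := by
    intro w
    have : ∀ i, (1 - if w i = 0 then (1 : ℝ) else 0) = if w i ≠ 0 then 1 else 0 := by
      intro i; by_cases h : w i = 0 <;> simp [h]
    simp only [this, sum_boole]
    rfl
  simp only [hnorm]
  rw [sum_comm, mul_sum]
  have hcoord : ∀ i : Fin s, (Fintype.card F : ℝ) *
      ∑ w : Fin s → F with ∑ l, w l = 0, (1 - if w i = 0 then (1 : ℝ) else 0)
      = (Fintype.card F - 1) * #{w : Fin s → F | ∑ l, w l = 0} := by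
    intro i
    obtain ⟨j, hj⟩ := exists_ne i
    have h := congrArg (Nat.cast (R := ℝ)) (card_mul_card_zeroSum_coord (F := F) hj.symm)
    push_cast at h
    rw [sum_sub_distrib, sum_boole, filter_filter, sum_const, nsmul_eq_mul, mul_sub, h]
    ring
  rw [sum_congr rfl fun i _ => hcoord i]
  simp

lemma tiltedMean_one_zeroSum [Fintype F] (hs : 2 ≤ s) :
    tiltedMean (univ.filter fun w : Fin s → F => ∑ i, w i = 0) hammingNorm 1
      = s * ((Fintype.card F - 1) / Fintype.card F) := by
  have hq : (Fintype.card F : ℝ) ≠ 0 := by simp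
  have hW : (#{w : Fin s → F | ∑ l, w l = 0} : ℝ) ≠ 0 := by
    rw [Nat.cast_ne_zero, card_ne_zero]
    exact ⟨0, by simp⟩
  have h := card_mul_sum_hammingNorm_zeroSum (F := F) hs
  simp only [tiltedMean, one_pow, one_mul, sum_const, nsmul_eq_mul, mul_one]
  field_simp
  linarith

lemma exists_zeroSum_hammingNorm_ne_zero (hs : 2 ≤ s) :
    ∃ w : Fin s → F, ∑ i, w i = 0 ∧ hammingNorm w ≠ 0 := by
  have : Nontrivial (Fin s) := Fin.nontrivial_iff_two_le.2 hs
  obtain ⟨i, j, hij⟩ := exists_pair_ne (Fin s)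
  refine ⟨Pi.single i 1 - Pi.single j 1, by simp [sum_sub_distrib], ?_⟩
  rw [hammingNorm_ne_zero_iff]
  intro h
  simpa [hij] using congrFun h i

end ZeroSum

/-- **Claim 5.9.** The function
`g(β) = E_{w∼μ_q(β)^s}[wt(w) | ∑ w_i = 0]` is strictly increasing on `(0,(q−1)/q]`;
moreover `g(β) → 0` as `β → 0⁺` and `g((q−1)/q) = (q−1)/q`. -/
theorem condWt_strictMono
    (q : ℕ) (F : Type) [Field F] [Fintype F] [DecidableEq F]
    (hcard : Fintype.card F = q) (s : ℕ) (hs : 2 ≤ s) :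
    StrictMonoOn (condWt F q s) (Set.Ioc (0 : ℝ) (((q : ℝ) - 1) / q)) ∧
    Filter.Tendsto (condWt F q s) (nhdsWithin 0 (Set.Ioi 0)) (nhds 0) ∧
    condWt F q s (((q : ℝ) - 1) / q) = ((q : ℝ) - 1) / q := by
  have hq : (1 : ℝ) < q := by
    rw [← hcard]
    exact_mod_cast Fintype.one_lt_card
  have hq1 : (0 : ℝ) < q - 1 := sub_pos.2 hq
  have hend : ((q : ℝ) - 1) / q < 1 := by
    rw [div_lt_one (by linarith)]
    linarith
  have hs0 : (0 : ℝ) < s := by exact_mod_cast (by omega : 0 < s)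
  refine ⟨?_, ?_, ?_⟩
  · rintro β ⟨hβ, -⟩ γ ⟨hγ, hγq⟩ hβγ
    have hγ1 : γ < 1 := hγq.trans_lt hend
    have hβ1 : β < 1 := hβγ.trans hγ1
    have hβ' : 0 < 1 - β := sub_pos.2 hβ1
    have hγ' : 0 < 1 - γ := sub_pos.2 hγ1
    rw [condWt_eq_tiltedMean q hβ1.ne, condWt_eq_tiltedMean q hγ1.ne]
    obtain ⟨w, hw, hw0⟩ := exists_zeroSum_hammingNorm_ne_zero (F := F) hs
    refine div_lt_div_of_pos_right (tiltedMean_strictMonoOn (a := w) (b := 0) (by simpa using hw)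
      (by simp) (by simpa using hw0) (Set.mem_Ioi.2 (by positivity))
      (Set.mem_Ioi.2 (by positivity)) ?_) hs0
    gcongr
  · have hcont : ContinuousAt (fun β : ℝ => β / (q - 1) / (1 - β)) 0 :=
      ContinuousAt.div (by fun_prop) (by fun_prop) (by norm_num)
    have hmean : ContinuousAt (fun β : ℝ => tiltedMean
        (univ.filter fun w : Fin s → F => ∑ i, w i = 0) hammingNorm
        (β / (q - 1) / (1 - β)) / s) 0 := by
      refine ContinuousAt.div_const (ContinuousAt.comp' ?_ hcont) _
      simpa using continuousAt_tiltedMean_zero (W := univ.filter fun w : Fin s → F => ∑ i, w i = 0)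
        (a := 0) (by simp) hammingNorm_zero
    have hlim := hmean.tendsto
    simp only [zero_div, tiltedMean_zero] at hlim
    refine (hlim.congr' ?_).mono_left nhdsWithin_le_nhds
    filter_upwards [eventually_ne_nhds (zero_ne_one' ℝ)] with β hβ
    exact (condWt_eq_tiltedMean q hβ).symm
  · have hratio : ((q : ℝ) - 1) / q / (q - 1) / (1 - (q - 1) / q) = 1 := by
      have : (q : ℝ) ≠ 0 := by linarith
      field_simp
      ring
    rw [condWt_eq_tiltedMean q hend.ne, hratio, tiltedMean_one_zeroSum hs, hcard]
    field_simp
end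

section
/- Fix a prime power q and an integer s ≥ 3. For every y ∈ (−s/2, −1], there is at most one λ ∈ (0, (q−1)/q] satisfying φ(λ) = y · h_q(λ). -/
open Finset

/-- `Z(β) = (1 + (q−1)(1 − qβ/(q−1))^s)/q`, the probability that `s` i.i.d. samples from
`μ_q(β)` sum to zero. -/
noncomputable def Zfun (q s : ℕ) (β : ℝ) : ℝ :=
  (1 + ((q : ℝ) - 1) * (1 - (q : ℝ) * β / ((q : ℝ) - 1)) ^ s) / q

/-- The base-`q` KL divergence `D_q(λ‖β)`. -/
noncomputable def klDiv (q : ℕ) (lam β : ℝ) : ℝ :=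
  lam * Real.logb q (lam / β) + (1 - lam) * Real.logb q ((1 - lam) / (1 - β))

/-- `ψ(λ,β) = s·D_q(λ‖β) + log_q Z(β)`. -/
noncomputable def psiFun (q s : ℕ) (lam β : ℝ) : ℝ :=
  (s : ℝ) * klDiv q lam β + Real.logb q (Zfun q s β)

/-- `φ(λ) = inf_{β ∈ (0,(q−1)/q]} ψ(λ,β)`. -/
noncomputable def phiFun (q s : ℕ) (lam : ℝ) : ℝ :=
  sInf (psiFun q s lam '' Set.Ioc 0 (((q : ℝ) - 1) / q))

/-- The `q`-ary entropy function. -/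
noncomputable def qEntropy (q : ℕ) (x : ℝ) : ℝ :=
  x * Real.logb q (q - 1) - x * Real.logb q x - (1 - x) * Real.logb q (1 - x)

section CriticalPoint

open Set Real

/-- The logarithm of `(1 + a r) / (1 - r)`. -/
noncomputable def logRatio (a r : ℝ) : ℝ := log (1 + a * r) - log (1 - r)

lemma logRatio_pos {a r : ℝ} (ha : 0 < a) (hr : r ∈ Ioo (0 : ℝ) 1) : 0 < logRatio a r := by
  have h : 0 < a * r := mul_pos ha hr.1
  exact sub_pos.2 (log_lt_log (by linarith [hr.2]) (by linarith [hr.1]))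

lemma hasDerivAt_logRatio {a r : ℝ} (ha : 0 < a) (hr : r ∈ Ioo (0 : ℝ) 1) :
    HasDerivAt (logRatio a) ((a + 1) / ((1 + a * r) * (1 - r))) r := by
  have h1 : 0 < 1 + a * r := by have := mul_pos ha hr.1; linarith
  have h2 : 0 < 1 - r := by linarith [hr.2]
  have d1 : HasDerivAt (fun x : ℝ => 1 + a * x) a r := by
    simpa using ((hasDerivAt_id r).const_mul a).const_add 1
  have d2 : HasDerivAt (fun x : ℝ => 1 - x) (-1) r := by
    simpa using (hasDerivAt_id r).const_sub 1
  refine ((d1.log h1.ne').sub (d2.log h2.ne')).congr_deriv ?_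
  field_simp
  ring

lemma strictAntiOn_log_mul_elasticity_logRatio {a : ℝ} (ha : 0 < a) :
    StrictAntiOn (fun r => -log r * (r * ((a + 1) / ((1 + a * r) * (1 - r)))) / logRatio a r)
      (Ioo (0 : ℝ) 1) := by
  intro t ht r hr htr
  have factor : ∀ x ∈ Ioo (0 : ℝ) 1,
      -log x * (x * ((a + 1) / ((1 + a * x) * (1 - x)))) / logRatio a x =
        (log x - log 1) / (x - 1) /
          (((1 + a * x) / (1 - x) * log ((1 + a * x) / (1 - x)) - 1 * log 1) /
            ((1 + a * x) / (1 - x) - 1)) := by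
    intro x hx
    have h0 := hx.1
    have h1 : 0 < 1 + a * x := by have := mul_pos ha hx.1; linarith
    have h2 : 0 < 1 - x := by linarith [hx.2]
    have h3 : x - 1 ≠ 0 := by linarith
    have hL := logRatio_pos ha hx
    have e : (1 + a * x) / (1 - x) - 1 = (a + 1) * x / (1 - x) := by
      field_simp
      ring
    rw [e, log_div h1.ne' h2.ne', log_one, ← logRatio, ← neg_sub 1 x]
    field_simp
    ring
  have hone : (1 : ℝ) ∈ Ioi (0 : ℝ) := mem_Ioi.2 one_pos
  have key1 := strictConcaveOn_log_Ioi.secant_strict_mono hone (mem_Ioi.2 ht.1) (mem_Ioi.2 hr.1)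
    ht.2.ne hr.2.ne htr
  have pos1 : 0 < (log r - log 1) / (r - 1) := by
    rw [log_one, sub_zero]
    exact div_pos_of_neg_of_neg (log_neg hr.1 hr.2) (by linarith [hr.2])
  have one_lt : ∀ x ∈ Ioo (0 : ℝ) 1, 1 < (1 + a * x) / (1 - x) := by
    intro x hx
    rw [one_lt_div (by linarith [hx.2])]
    have := mul_pos ha hx.1
    linarith [hx.1]
  have wlt : (1 + a * t) / (1 - t) < (1 + a * r) / (1 - r) := by
    have := mul_pos ha (sub_pos.2 htr)
    rw [div_lt_div_iff₀ (by linarith [ht.2]) (by linarith [hr.2])]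
    nlinarith
  have wt := one_lt t ht
  have wr := one_lt r hr
  have key2 := strictConvexOn_mul_log.secant_strict_mono (mem_Ici.2 zero_le_one)
    (mem_Ici.2 (zero_le_one.trans wt.le)) (mem_Ici.2 (zero_le_one.trans wr.le)) wt.ne' wr.ne' wlt
  have pos2 : 0 < ((1 + a * t) / (1 - t) * log ((1 + a * t) / (1 - t)) - 1 * log 1) /
      ((1 + a * t) / (1 - t) - 1) := by
    rw [log_one, mul_zero, sub_zero]
    exact div_pos (mul_pos (by linarith) (log_pos wt)) (by linarith)
  simp only [factor t ht, factor r hr]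
  exact div_lt_div₀ key1 key2.le (pos1.trans key1).le pos2

lemma strictMonoOn_logRatio_pow_div {a : ℝ} (ha : 0 < a) {n : ℕ} (hn : 2 ≤ n) :
    StrictMonoOn (fun r => logRatio a (r ^ n) / logRatio a r) (Ioo (0 : ℝ) 1) := by
  have hmem : ∀ r ∈ Ioo (0 : ℝ) 1, r ^ n ∈ Ioo (0 : ℝ) 1 := fun r hr =>
    ⟨pow_pos hr.1 n, pow_lt_one₀ hr.1.le hr.2 (by omega)⟩
  have hder : ∀ r ∈ Ioo (0 : ℝ) 1, HasDerivAt (fun r => logRatio a (r ^ n) / logRatio a r) _ r :=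
    fun r hr => ((hasDerivAt_logRatio ha (hmem r hr)).comp r (hasDerivAt_pow n r)).div
      (hasDerivAt_logRatio ha hr) (logRatio_pos ha hr).ne'
  refine strictMonoOn_of_deriv_pos (convex_Ioo 0 1)
    (fun r hr => (hder r hr).continuousAt.continuousWithinAt) fun r hr => ?_
  rw [interior_Ioo] at hr
  rw [(hder r hr).deriv]
  have hlt : r ^ n < r := pow_lt_self_of_lt_one₀ hr.1 hr.2 (by omega)
  have key := strictAntiOn_log_mul_elasticity_logRatio ha (hmem r hr) hr hlt
  simp only [log_pow] at key
  rw [div_lt_div_iff₀ (logRatio_pos ha hr) (logRatio_pos ha (hmem r hr))] at key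
  refine div_pos ?_ (pow_pos (logRatio_pos ha hr) 2)
  have hlog : 0 < -log r * r := mul_pos (neg_pos.2 (log_neg hr.1 hr.2)) hr.1
  have hpow : r ^ n = r * r ^ (n - 1) := by
    rw [← pow_succ', Nat.sub_add_cancel (by omega)]
  refine pos_of_mul_pos_right (a := -log r * r) ?_ hlog.le
  simp only [Function.comp_apply]
  generalize (a + 1) / ((1 + a * r) * (1 - r)) = d at *
  generalize (a + 1) / ((1 + a * r ^ n) * (1 - r ^ n)) = d' at *
  generalize logRatio a (r ^ n) = M at *
  rw [hpow] at key
  linarith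

/-- The weight `λ` at which the tilting parameter `β = a (1 - r) / (a + 1)` is optimal. -/
noncomputable def critWeight (a : ℝ) (n : ℕ) (r : ℝ) : ℝ :=
  a * (1 - r) * (1 - r ^ n) / ((a + 1) * (1 + a * r ^ (n + 1)))

lemma critWeight_zero (a : ℝ) {n : ℕ} (hn : n ≠ 0) : critWeight a n 0 = a / (a + 1) := by
  simp [critWeight, hn]

lemma critWeight_one (a : ℝ) (n : ℕ) : critWeight a n 1 = 0 := by simp [critWeight]

lemma one_sub_critWeight {a r : ℝ} (ha : 0 < a) (n : ℕ) (hr : 0 ≤ r) :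
    1 - critWeight a n r =
      (1 + a * r) * (1 + a * r ^ n) / ((a + 1) * (1 + a * r ^ (n + 1))) := by
  have h : 0 < 1 + a * r ^ (n + 1) := by positivity
  rw [critWeight]
  field_simp
  ring

lemma critWeight_mem_Ioo {a r : ℝ} (ha : 0 < a) {n : ℕ} (hn : n ≠ 0) (hr : r ∈ Ico (0 : ℝ) 1) :
    critWeight a n r ∈ Ioo (0 : ℝ) 1 := by
  have h0 := hr.1
  have h1 : 0 < 1 - r := by linarith [hr.2]
  have h2 : 0 < 1 - r ^ n := by linarith [pow_lt_one₀ hr.1 hr.2 hn]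
  constructor
  · unfold critWeight
    positivity
  · rw [← sub_pos, one_sub_critWeight ha n h0]
    positivity

lemma continuousOn_critWeight {a : ℝ} (ha : 0 < a) (n : ℕ) :
    ContinuousOn (critWeight a n) (Icc 0 1) := by
  refine ContinuousOn.div (by fun_prop) (by fun_prop) fun r hr => ?_
  have := hr.1
  positivity

lemma exists_hasDerivAt_critWeight_neg {a r : ℝ} (ha : 0 < a) {n : ℕ} (hn : n ≠ 0)
    (hr : r ∈ Ioo (0 : ℝ) 1) : ∃ d < 0, HasDerivAt (critWeight a n) d r := by
  have h0 := hr.1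
  have h1 : 0 < 1 - r := by linarith [hr.2]
  have h2 : 0 < 1 - r ^ n := by linarith [pow_lt_one₀ hr.1.le hr.2 hn]
  have d1 : HasDerivAt (fun x : ℝ => a * (1 - x)) (a * (-1)) r := by
    simpa using ((hasDerivAt_id r).const_sub 1).const_mul a
  have d2 : HasDerivAt (fun x : ℝ => 1 - x ^ n) (-(n * r ^ (n - 1))) r :=
    (hasDerivAt_pow n r).const_sub 1
  have d3 : HasDerivAt (fun x : ℝ => (a + 1) * (1 + a * x ^ (n + 1)))
      ((a + 1) * (a * ((n + 1 : ℕ) * r ^ n))) r :=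
    (((hasDerivAt_pow (n + 1) r).const_mul a).const_add 1).const_mul (a + 1)
  refine ⟨_, ?_, (d1.mul d2).div d3 (by positivity)⟩
  refine div_neg_of_neg_of_pos ?_ (by positivity)
  have p1 : 0 < (a * (1 - r ^ n) + a * (1 - r) * (n * r ^ (n - 1))) *
      ((a + 1) * (1 + a * r ^ (n + 1))) := by positivity
  have p2 : 0 < a * (1 - r) * (1 - r ^ n) * ((a + 1) * (a * ((n + 1 : ℕ) * r ^ n))) := by
    positivity
  simp only [Pi.mul_apply]
  linarith

lemma strictAntiOn_critWeight {a : ℝ} (ha : 0 < a) {n : ℕ} (hn : n ≠ 0) :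
    StrictAntiOn (critWeight a n) (Icc 0 1) := by
  refine strictAntiOn_of_deriv_neg (convex_Icc 0 1) (continuousOn_critWeight ha n) fun r hr => ?_
  rw [interior_Icc] at hr
  obtain ⟨d, hd, h⟩ := exists_hasDerivAt_critWeight_neg ha hn hr
  rwa [h.deriv]

/-- The part of `ψ(λ, β)` depending on `β = a (1 - r) / (a + 1)`, in natural logarithms. -/
noncomputable def tiltCost (a : ℝ) (n : ℕ) (l r : ℝ) : ℝ :=
  log (1 + a * r ^ (n + 1)) - (n + 1) * (l * log (1 - r)) - (n + 1) * ((1 - l) * log (1 + a * r))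

lemma continuousOn_tiltCost {a : ℝ} (ha : 0 < a) (n : ℕ) (l : ℝ) :
    ContinuousOn (tiltCost a n l) (Ico 0 1) := by
  unfold tiltCost
  intro r hr
  have h0 := hr.1
  have h1 : 1 - r ≠ 0 := by linarith [hr.2]
  have h2 : 1 + a * r ≠ 0 := by positivity
  have h3 : 1 + a * r ^ (n + 1) ≠ 0 := by positivity
  exact ContinuousAt.continuousWithinAt (by fun_prop (disch := assumption))

lemma HasDerivAt.tiltCost_comp {a r d : ℝ} (ha : 0 < a) (n : ℕ) (hr : r ∈ Ioo (0 : ℝ) 1)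
    {f : ℝ → ℝ} (hf : HasDerivAt f d r) :
    HasDerivAt (fun x => tiltCost a n (f x) x)
      ((n + 1) * d * logRatio a r + (n + 1) * (a + 1) / ((1 + a * r) * (1 - r)) *
        (f r - critWeight a n r)) r := by
  have h0 := hr.1
  have h1 : 0 < 1 - r := by linarith [hr.2]
  have h2 : 0 < 1 + a * r := by positivity
  have h3 : 0 < 1 + a * r ^ (n + 1) := by positivity
  have d1 : HasDerivAt (fun x : ℝ => 1 + a * x ^ (n + 1)) (a * ((n + 1 : ℕ) * r ^ n)) r :=
    ((hasDerivAt_pow (n + 1) r).const_mul a).const_add 1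
  have d2 : HasDerivAt (fun x : ℝ => 1 - x) (-1) r := by
    simpa using (hasDerivAt_id r).const_sub 1
  have d3 : HasDerivAt (fun x : ℝ => 1 + a * x) a r := by
    simpa using ((hasDerivAt_id r).const_mul a).const_add 1
  refine (((d1.log h3.ne').sub ((hf.mul (d2.log h1.ne')).const_mul (n + 1 : ℝ))).sub
    (((hf.const_sub 1).mul (d3.log h2.ne')).const_mul (n + 1 : ℝ))).congr_deriv ?_
  rw [logRatio, critWeight]
  push_cast
  field_simp
  ring

lemma tiltCost_critWeight_le {a : ℝ} (ha : 0 < a) {n : ℕ} (hn : n ≠ 0) {r₀ r : ℝ}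
    (hr₀ : r₀ ∈ Ico (0 : ℝ) 1) (hr : r ∈ Ico (0 : ℝ) 1) :
    tiltCost a n (critWeight a n r₀) r₀ ≤ tiltCost a n (critWeight a n r₀) r := by
  have hder : ∀ x ∈ Ioo (0 : ℝ) 1, deriv (tiltCost a n (critWeight a n r₀)) x =
      (n + 1) * (a + 1) / ((1 + a * x) * (1 - x)) * (critWeight a n r₀ - critWeight a n x) := by
    intro x hx
    have := ((hasDerivAt_const x (critWeight a n r₀)).tiltCost_comp ha n hx).deriv
    simpa using this
  have hpos : ∀ x ∈ Ioo (0 : ℝ) 1, 0 ≤ (n + 1) * (a + 1) / ((1 + a * x) * (1 - x)) := by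
    intro x hx
    have h0 := hx.1
    have h1 : 0 < 1 - x := by linarith [hx.2]
    positivity
  have anti := (strictAntiOn_critWeight ha hn).antitoneOn
  have hcont := continuousOn_tiltCost ha n (critWeight a n r₀)
  rcases le_total r₀ r with h | h
  · have hsub : Icc r₀ r ⊆ Ico 0 1 := fun x hx => ⟨hr₀.1.trans hx.1, hx.2.trans_lt hr.2⟩
    refine monotoneOn_of_deriv_nonneg (convex_Icc r₀ r) (hcont.mono hsub) (fun x hx => ?_)
      (fun x hx => ?_) (left_mem_Icc.2 h) (right_mem_Icc.2 h) h
    all_goals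
      rw [interior_Icc] at hx
      have hx' : x ∈ Ioo (0 : ℝ) 1 := ⟨hr₀.1.trans_lt hx.1, hx.2.trans hr.2⟩
    · exact ((hasDerivAt_const x (critWeight a n r₀)).tiltCost_comp ha n
        hx').differentiableAt.differentiableWithinAt
    · rw [hder x hx']
      exact mul_nonneg (hpos x hx') (sub_nonneg.2 (anti (Ico_subset_Icc_self hr₀)
        (Ioo_subset_Icc_self hx') hx.1.le))
  · have hsub : Icc r r₀ ⊆ Ico 0 1 := fun x hx => ⟨hr.1.trans hx.1, hx.2.trans_lt hr₀.2⟩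
    refine antitoneOn_of_deriv_nonpos (convex_Icc r r₀) (hcont.mono hsub) (fun x hx => ?_)
      (fun x hx => ?_) (left_mem_Icc.2 h) (right_mem_Icc.2 h) h
    all_goals
      rw [interior_Icc] at hx
      have hx' : x ∈ Ioo (0 : ℝ) 1 := ⟨hr.1.trans_lt hx.1, hx.2.trans hr₀.2⟩
    · exact ((hasDerivAt_const x (critWeight a n r₀)).tiltCost_comp ha n
        hx').differentiableAt.differentiableWithinAt
    · rw [hder x hx']
      exact mul_nonpos_of_nonneg_of_nonpos (hpos x hx') (sub_nonpos.2 (anti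
        (Ioo_subset_Icc_self hx') (Ico_subset_Icc_self hr₀) hx.2.le))

/-- `φ(λ) - y h(λ)` along `λ = critWeight a n r`, in natural logarithms, with `c = s + y`. -/
noncomputable def critGap (a : ℝ) (n : ℕ) (c r : ℝ) : ℝ :=
  n * log (a + 1) + tiltCost a n (critWeight a n r) r -
    c * (critWeight a n r * log a + binEntropy (critWeight a n r))

lemma critGap_one {a : ℝ} (n : ℕ) (c : ℝ) : critGap a n c 1 = 0 := by
  simp [critGap, tiltCost, critWeight_one, add_comm]
  ring

lemma continuousOn_critGap {a : ℝ} (ha : 0 < a) (n : ℕ) (c : ℝ) :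
    ContinuousOn (critGap a n c) (Icc 0 1) := by
  have hw := continuousOn_critWeight ha n
  have hlog : ContinuousOn (fun r => critWeight a n r * log (1 - r)) (Icc 0 1) := by
    have hml : Continuous fun r : ℝ => (1 - r) * log (1 - r) :=
      continuous_mul_log.comp (continuous_const.sub continuous_id)
    have : ContinuousOn (fun r : ℝ => a * (1 - r ^ n) / ((a + 1) * (1 + a * r ^ (n + 1))))
        (Icc 0 1) := by
      refine ContinuousOn.div (by fun_prop) (by fun_prop) fun r hr => ?_
      have := hr.1
      positivity
    refine (this.mul hml.continuousOn).congr fun r _ => ?_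
    rw [critWeight, Pi.mul_apply]
    ring
  have hlog1 : ContinuousOn (fun r : ℝ => log (1 + a * r)) (Icc 0 1) := by
    refine ContinuousOn.log (by fun_prop) fun r hr => ?_
    have := hr.1
    positivity
  have hlog2 : ContinuousOn (fun r : ℝ => log (1 + a * r ^ (n + 1))) (Icc 0 1) := by
    refine ContinuousOn.log (by fun_prop) fun r hr => ?_
    have := hr.1
    positivity
  have hent := binEntropy_continuous.comp_continuousOn hw
  exact (continuousOn_const.add ((hlog2.sub (continuousOn_const.mul hlog)).sub
    (continuousOn_const.mul ((continuousOn_const.sub hw).mul hlog1)))).sub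
    (continuousOn_const.mul ((hw.mul continuousOn_const).add hent))

lemma exists_hasDerivAt_critGap {a r : ℝ} (ha : 0 < a) {n : ℕ} (hn : n ≠ 0) (c : ℝ)
    (hr : r ∈ Ioo (0 : ℝ) 1) : ∃ d < 0, HasDerivAt (critGap a n c)
      (d * ((n + 1) * logRatio a r - c * (logRatio a r + logRatio a (r ^ n)))) r := by
  obtain ⟨d, hd, h⟩ := exists_hasDerivAt_critWeight_neg ha hn hr
  have hw := critWeight_mem_Ioo ha hn (Ioo_subset_Ico_self hr)
  refine ⟨d, hd, ((h.tiltCost_comp ha n hr).const_add (n * log (a + 1))).sub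
    (((h.mul_const (log a)).add ((hasDerivAt_binEntropy hw.1.ne' hw.2.ne).comp r h)).const_mul c)
    |>.congr_deriv ?_⟩
  have h0 := hr.1
  have h1 : 0 < 1 - r := by linarith [hr.2]
  have h2 : 0 < 1 - r ^ n := by linarith [pow_lt_one₀ hr.1.le hr.2 hn]
  have key : log a + log (1 - critWeight a n r) - log (critWeight a n r) =
      logRatio a r + logRatio a (r ^ n) := by
    rw [one_sub_critWeight ha n h0.le, critWeight, logRatio, logRatio,
      log_div (by positivity) (by positivity), log_div (by positivity) (by positivity),
      log_mul (x := 1 + a * r) (by positivity) (by positivity),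
      log_mul (x := a * (1 - r)) (by positivity) (by positivity),
      log_mul (x := a) (by positivity) (by positivity)]
    ring
  rw [← key]
  ring

lemma critGap_zero_unique {a : ℝ} (ha : 0 < a) {n : ℕ} (hn : 2 ≤ n) {c : ℝ} (hc : 0 < c)
    {r₁ r₂ : ℝ} (h₁ : 0 ≤ r₁) (h₁₂ : r₁ < r₂) (h₂ : r₂ < 1) (hz₁ : critGap a n c r₁ = 0) :
    critGap a n c r₂ ≠ 0 := by
  intro hz₂
  have hn0 : n ≠ 0 := by omega
  have rolle : ∀ u v : ℝ, 0 ≤ u → u < v → v ≤ 1 → critGap a n c u = 0 → critGap a n c v = 0 →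
      ∃ r ∈ Ioo u v, logRatio a (r ^ n) / logRatio a r = (n + 1) / c - 1 := by
    intro u v hu huv hv zu zv
    have hsub : ∀ r ∈ Ioo u v, r ∈ Ioo (0 : ℝ) 1 := fun r hr =>
      ⟨hu.trans_lt hr.1, hr.2.trans_le hv⟩
    obtain ⟨r, hr, hd⟩ := exists_deriv_eq_zero huv
      ((continuousOn_critGap ha n c).mono (Icc_subset_Icc hu hv)) (zu.trans zv.symm)
    refine ⟨r, hr, ?_⟩
    obtain ⟨d, hneg, h⟩ := exists_hasDerivAt_critGap ha hn0 c (hsub r hr)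
    rw [h.deriv] at hd
    have := (mul_eq_zero.1 hd).resolve_left hneg.ne
    have hL := logRatio_pos ha (hsub r hr)
    field_simp
    linarith
  obtain ⟨x, hx, ex⟩ := rolle r₁ r₂ h₁ h₁₂ h₂.le hz₁ hz₂
  obtain ⟨y, hy, ey⟩ := rolle r₂ 1 (h₁.trans h₁₂.le) h₂ le_rfl hz₂ (critGap_one n c)
  exact (strictMonoOn_logRatio_pow_div ha hn ⟨h₁.trans_lt hx.1, hx.2.trans h₂⟩
    ⟨(h₁.trans_lt h₁₂).trans hy.1, hy.2⟩ (hx.2.trans hy.1)).ne (ex.trans ey.symm)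

lemma exists_critWeight_eq {a : ℝ} {n : ℕ} (ha : 0 < a) (hn : n ≠ 0) {l : ℝ}
    (hl : l ∈ Ioc 0 (a / (a + 1))) : ∃ r ∈ Ico (0 : ℝ) 1, critWeight a n r = l := by
  have := intermediate_value_Icc' zero_le_one (continuousOn_critWeight ha n)
  rw [critWeight_zero a hn, critWeight_one] at this
  obtain ⟨r, hr, rfl⟩ := this (Ioc_subset_Icc_self hl)
  refine ⟨r, ⟨hr.1, lt_of_le_of_ne hr.2 ?_⟩, rfl⟩
  rintro rfl
  simpa [critWeight_one] using hl.1

end CriticalPoint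

lemma psiFun_eq_tiltCost {q : ℕ} (hq : 2 ≤ q) (n : ℕ) {l r : ℝ} (hl : l ∈ Set.Ioo (0 : ℝ) 1)
    (hr : r ∈ Set.Ico (0 : ℝ) 1) :
    psiFun q (n + 1) l (((q : ℝ) - 1) * (1 - r) / q) =
      (n * Real.log q + tiltCost (q - 1) n l r) / Real.log q - (n + 1) * qEntropy q l := by
  have hq' : (2 : ℝ) ≤ q := by exact_mod_cast hq
  have ha : (0 : ℝ) < (q : ℝ) - 1 := by linarith
  have hq0 : (0 : ℝ) < q := by linarith
  have hlog : 0 < Real.log q := Real.log_pos (by linarith)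
  have h0 := hr.1
  have h1 : 0 < 1 - r := by linarith [hr.2]
  have hl0 := hl.1
  have hl1 : 0 < 1 - l := by linarith [hl.2]
  have hβ : 1 - ((q : ℝ) - 1) * (1 - r) / q = (1 + (q - 1) * r) / q := by
    field_simp
    ring
  have hx : 1 - (q : ℝ) * (((q : ℝ) - 1) * (1 - r) / q) / ((q : ℝ) - 1) = r := by
    field_simp
    ring
  rw [psiFun, klDiv, Zfun, hβ, hx, tiltCost, qEntropy]
  simp only [Real.logb]
  rw [Real.log_div hl0.ne' (by positivity), Real.log_div hl1.ne' (by positivity),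
    Real.log_div (by positivity) hq0.ne', Real.log_mul ha.ne' h1.ne',
    Real.log_div (by positivity) hq0.ne', Real.log_div (by positivity) hq0.ne']
  push_cast
  field_simp
  ring

lemma phiFun_critWeight {q : ℕ} (hq : 2 ≤ q) {n : ℕ} (hn : n ≠ 0) {r : ℝ}
    (hr : r ∈ Set.Ico (0 : ℝ) 1) :
    phiFun q (n + 1) (critWeight (q - 1) n r) =
      (n * Real.log q + tiltCost (q - 1) n (critWeight (q - 1) n r) r) / Real.log q -
        (n + 1) * qEntropy q (critWeight (q - 1) n r) := by
  have hq' : (2 : ℝ) ≤ q := by exact_mod_cast hq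
  have ha : (0 : ℝ) < (q : ℝ) - 1 := by linarith
  have hq0 : (0 : ℝ) < q := by linarith
  have hlog : 0 < Real.log q := Real.log_pos (by linarith)
  have hw := critWeight_mem_Ioo ha hn hr
  refine IsLeast.csInf_eq ⟨⟨((q : ℝ) - 1) * (1 - r) / q, ⟨?_, ?_⟩, ?_⟩, ?_⟩
  · have : 0 < 1 - r := by linarith [hr.2]
    positivity
  · gcongr
    nlinarith [hr.1]
  · exact psiFun_eq_tiltCost hq n hw hr
  · rintro _ ⟨β, hβ, rfl⟩
    have hr' : 1 - q * β / ((q : ℝ) - 1) ∈ Set.Ico (0 : ℝ) 1 := by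
      have hβ0 := hβ.1
      have hβ1 := (le_div_iff₀ hq0).1 hβ.2
      refine ⟨sub_nonneg.2 ((div_le_one ha).2 (by linarith)), ?_⟩
      have : 0 < q * β / ((q : ℝ) - 1) := by positivity
      linarith
    have e : β = ((q : ℝ) - 1) * (1 - (1 - q * β / ((q : ℝ) - 1))) / q := by
      field_simp
      ring
    rw [e, psiFun_eq_tiltCost hq n hw hr']
    gcongr
    exact tiltCost_critWeight_le ha hn hr hr'

lemma critGap_eq_zero_of_phiFun_eq {q : ℕ} (hq : 2 ≤ q) {n : ℕ} (hn : n ≠ 0) {r y : ℝ}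
    (hr : r ∈ Set.Ico (0 : ℝ) 1)
    (h : phiFun q (n + 1) (critWeight (q - 1) n r) = y * qEntropy q (critWeight (q - 1) n r)) :
    critGap (q - 1) n (n + 1 + y) r = 0 := by
  have hq' : (2 : ℝ) ≤ q := by exact_mod_cast hq
  have hlog : 0 < Real.log q := Real.log_pos (by linarith)
  rw [phiFun_critWeight hq hn hr, qEntropy] at h
  simp only [Real.logb] at h
  rw [critGap, Real.binEntropy, sub_add_cancel, Real.log_inv, Real.log_inv]
  field_simp at h
  linarith

/-- **Claim 5.13.** For every `y ∈ (−s/2, −1]`, the equation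
`φ(λ) = y·h_q(λ)` has at most one solution `λ ∈ (0,(q−1)/q]`. -/
theorem phi_eq_y_entropy_unique_solution
    (q : ℕ) (F : Type) [Field F] [Fintype F] [DecidableEq F]
    (hcard : Fintype.card F = q) (s : ℕ) (hs : 3 ≤ s) :
    ∀ y ∈ Set.Ioc (-((s : ℝ) / 2)) (-1 : ℝ),
      ∀ lam₁ ∈ Set.Ioc (0 : ℝ) (((q : ℝ) - 1) / q),
        ∀ lam₂ ∈ Set.Ioc (0 : ℝ) (((q : ℝ) - 1) / q),
          phiFun q s lam₁ = y * qEntropy q lam₁ →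
          phiFun q s lam₂ = y * qEntropy q lam₂ →
          lam₁ = lam₂ := by
  intro y hy l₁ hl₁ l₂ hl₂ h₁ h₂
  have hq : 2 ≤ q := hcard ▸ Fintype.one_lt_card
  obtain ⟨n, rfl⟩ : ∃ n, s = n + 1 := ⟨s - 1, by omega⟩
  have hn : n ≠ 0 := by omega
  have hq' : (2 : ℝ) ≤ q := by exact_mod_cast hq
  have ha : (0 : ℝ) < (q : ℝ) - 1 := by linarith
  have hc : 0 < (n : ℝ) + 1 + y := by
    have := hy.1
    push_cast at this
    have : (0 : ℝ) ≤ n := n.cast_nonneg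
    linarith
  have hqa : (q : ℝ) = (q : ℝ) - 1 + 1 := by ring
  obtain ⟨r₁, hr₁, rfl⟩ := exists_critWeight_eq ha hn (by rwa [← hqa] : l₁ ∈ Set.Ioc _ _)
  obtain ⟨r₂, hr₂, rfl⟩ := exists_critWeight_eq ha hn (by rwa [← hqa] : l₂ ∈ Set.Ioc _ _)
  have z₁ := critGap_eq_zero_of_phiFun_eq hq hn hr₁ h₁
  have z₂ := critGap_eq_zero_of_phiFun_eq hq hn hr₂ h₂
  rcases lt_trichotomy r₁ r₂ with h | rfl | h
  · exact absurd z₂ (critGap_zero_unique ha (by omega) hc hr₁.1 h hr₂.2 z₁)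
  · rfl
  · exact absurd z₁ (critGap_zero_unique ha (by omega) hc hr₂.1 h hr₁.2 z₂)
end

section
/- Fix a prime power q and an integer s ≥ 3. There exists λ ∈ (0, (q−1)/q) such that φ(λ)/h_q(λ) < −1. -/
open Finset

theorem klDiv_nonneg {q : ℕ} (hq : 2 ≤ q) {lam β : ℝ} (hl0 : 0 < lam) (hl1 : lam < 1)
    (hb0 : 0 < β) (hb1 : β < 1) : 0 ≤ klDiv q lam β := by
  have hlog : 0 < Real.log q := Real.log_pos (by exact_mod_cast hq)
  have h1 := Real.one_sub_inv_le_log_of_pos (div_pos hl0 hb0)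
  have h2 := Real.one_sub_inv_le_log_of_pos (div_pos (sub_pos.2 hl1) (sub_pos.2 hb1))
  have h3 := mul_le_mul_of_nonneg_left h1 hl0.le
  have h4 := mul_le_mul_of_nonneg_left h2 (sub_pos.2 hl1).le
  have e3 : lam * (1 - (lam / β)⁻¹) = lam - β := by field_simp
  have e4 : (1 - lam) * (1 - ((1 - lam) / (1 - β))⁻¹) = β - lam := by
    have := (sub_pos.2 hl1).ne'
    field_simp
    ring
  have : klDiv q lam β =
      (lam * Real.log (lam / β) + (1 - lam) * Real.log ((1 - lam) / (1 - β))) / Real.log q := by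
    unfold klDiv Real.logb
    ring
  rw [this]
  exact div_nonneg (by linarith) hlog.le

theorem klDiv_self (q : ℕ) {lam : ℝ} (hl0 : 0 < lam) (hl1 : lam < 1) : klDiv q lam lam = 0 := by
  simp [klDiv, div_self hl0.ne', div_self (sub_pos.2 hl1).ne']

theorem inv_le_Zfun {q : ℕ} (hq : 2 ≤ q) (s : ℕ) {β : ℝ} (hb : β ≤ ((q : ℝ) - 1) / q) :
    (q : ℝ)⁻¹ ≤ Zfun q s β := by
  have hq' : (2 : ℝ) ≤ q := by exact_mod_cast hq
  have hx : 0 ≤ 1 - (q : ℝ) * β / ((q : ℝ) - 1) := by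
    rw [le_div_iff₀ (by linarith)] at hb
    rw [sub_nonneg, div_le_one (by linarith)]
    linarith
  have := mul_nonneg (by linarith : (0 : ℝ) ≤ q - 1) (pow_nonneg hx s)
  rw [Zfun, inv_eq_one_div]
  gcongr
  linarith

theorem bddBelow_psiFun {q : ℕ} (hq : 2 ≤ q) (s : ℕ) {lam : ℝ} (hl0 : 0 < lam) (hl1 : lam < 1) :
    BddBelow (psiFun q s lam '' Set.Ioc 0 (((q : ℝ) - 1) / q)) := by
  have hq' : (2 : ℝ) ≤ q := by exact_mod_cast hq
  refine ⟨Real.logb q (q : ℝ)⁻¹, ?_⟩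
  rintro _ ⟨β, ⟨hb0, hb⟩, rfl⟩
  have hb1 : β < 1 := hb.trans_lt (by rw [div_lt_one (by linarith)]; linarith)
  have h1 := klDiv_nonneg hq hl0 hl1 hb0 hb1
  have h2 : Real.logb q (q : ℝ)⁻¹ ≤ Real.logb q (Zfun q s β) :=
    Real.logb_le_logb_of_le (by linarith) (by positivity) (inv_le_Zfun hq s hb)
  have h3 : 0 ≤ (s : ℝ) * klDiv q lam β := by positivity
  rw [psiFun]
  linarith

theorem phiFun_le_logb_Zfun {q : ℕ} (hq : 2 ≤ q) (s : ℕ) {lam : ℝ} (hl0 : 0 < lam)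
    (hl : lam ≤ ((q : ℝ) - 1) / q) : phiFun q s lam ≤ Real.logb q (Zfun q s lam) := by
  have hq' : (2 : ℝ) ≤ q := by exact_mod_cast hq
  have hl1 : lam < 1 := hl.trans_lt (by rw [div_lt_one (by linarith)]; linarith)
  refine csInf_le (bddBelow_psiFun hq s hl0 hl1) ⟨lam, ⟨hl0, hl⟩, ?_⟩
  rw [psiFun, klDiv_self q hl0 hl1]
  ring

theorem qEntropy_pos {q : ℕ} (hq : 2 ≤ q) {x : ℝ} (hx0 : 0 < x) (hx1 : x < 1) :
    0 < qEntropy q x := by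
  have hq' : (2 : ℝ) ≤ q := by exact_mod_cast hq
  have h1 : 0 ≤ x * Real.logb q (q - 1) :=
    mul_nonneg hx0.le (Real.logb_nonneg (by linarith) (by linarith))
  have h2 := mul_neg_of_pos_of_neg hx0 (Real.logb_neg (b := q) (by linarith) hx0 hx1)
  have h3 := mul_neg_of_pos_of_neg (sub_pos.2 hx1)
    (Real.logb_neg (b := q) (x := 1 - x) (by linarith) (by linarith) (by linarith))
  rw [qEntropy]
  linarith

theorem neg_add_sq_div_four_le_mul_log {d : ℝ} (hd0 : 0 ≤ d) (hd1 : d < 1) :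
    -d + d ^ 2 / 4 ≤ (1 - d) * Real.log (1 - d) := by
  have hd : 0 < 1 - d := sub_pos.2 hd1
  set r := √(1 - d) with hr
  have hr0 : 0 < r := Real.sqrt_pos.2 hd
  have hrr : r ^ 2 = 1 - d := Real.sq_sqrt hd.le
  have hle : r ≤ 1 - d / 2 - d ^ 2 / 8 :=
    Real.sqrt_le_iff.2 ⟨by nlinarith, by nlinarith [pow_nonneg hd0 3, pow_nonneg hd0 4]⟩
  have hl : Real.log (1 - d) = 2 * Real.log r := by rw [← hrr, Real.log_pow]; norm_num
  have h := mul_le_mul_of_nonneg_left (Real.one_sub_inv_le_log_of_pos hr0) (sq_nonneg r)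
  have e : r ^ 2 * (1 - r⁻¹) = r ^ 2 - r := by field_simp
  rw [hl, ← hrr]
  nlinarith

theorem le_one_add_mul_log_one_add {u : ℝ} (hu : 0 ≤ u) : u ≤ (1 + u) * Real.log (1 + u) := by
  have h := mul_le_mul_of_nonneg_left
    (Real.one_sub_inv_le_log_of_pos (by linarith : 0 < 1 + u)) (by linarith : 0 ≤ 1 + u)
  have e : (1 + u) * (1 - (1 + u)⁻¹) = u := by field_simp; ring
  linarith

/-- Near the uniform point `(q - 1) / q`, the entropy deficit is at least quadratic. -/
theorem qEntropy_mul_log_le {q : ℕ} (hq : 2 ≤ q) {d : ℝ} (hd0 : 0 ≤ d) (hd1 : d < 1) :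
    qEntropy q (((q : ℝ) - 1) / q * (1 - d)) * Real.log q ≤
      Real.log q - ((q : ℝ) - 1) / q * (d ^ 2 / 4) := by
  have hq' : (2 : ℝ) ≤ q := by exact_mod_cast hq
  have hq0 : (0 : ℝ) < q := by linarith
  have hq1 : (0 : ℝ) < q - 1 := by linarith
  have hlog : 0 < Real.log q := Real.log_pos (by linarith)
  have hd : 0 < 1 - d := sub_pos.2 hd1
  have hu : 0 ≤ ((q : ℝ) - 1) * d := by positivity
  have h1 := mul_le_mul_of_nonneg_left (neg_add_sq_div_four_le_mul_log hd0 hd1)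
    (div_pos hq1 hq0).le
  have h2 := div_le_div_of_nonneg_right (le_one_add_mul_log_one_add hu) hq0.le
  have hcompl : 1 - ((q : ℝ) - 1) / q * (1 - d) = (1 + ((q : ℝ) - 1) * d) / q := by
    field_simp
    ring
  have hl1 : Real.log (((q : ℝ) - 1) / q * (1 - d)) =
      Real.log (q - 1) - Real.log q + Real.log (1 - d) := by
    rw [Real.log_mul (by positivity) hd.ne', Real.log_div hq1.ne' hq0.ne']
  have hl2 : Real.log ((1 + ((q : ℝ) - 1) * d) / q) =
      Real.log (1 + ((q : ℝ) - 1) * d) - Real.log q :=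
    Real.log_div (by positivity) hq0.ne'
  have key : qEntropy q (((q : ℝ) - 1) / q * (1 - d)) * Real.log q =
      Real.log q - ((q : ℝ) - 1) / q * ((1 - d) * Real.log (1 - d)) -
        (1 + ((q : ℝ) - 1) * d) * Real.log (1 + ((q : ℝ) - 1) * d) / q := by
    rw [qEntropy, hcompl]
    unfold Real.logb
    rw [hl1, hl2]
    field_simp
    ring
  have e : ((q : ℝ) - 1) / q * (-d + d ^ 2 / 4) + ((q : ℝ) - 1) * d / q =
      ((q : ℝ) - 1) / q * (d ^ 2 / 4) := by ring
  linarith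

theorem logb_Zfun_mul_log_le {q : ℕ} (hq : 2 ≤ q) (s : ℕ) {d : ℝ} (hd0 : 0 ≤ d) :
    Real.logb q (Zfun q s (((q : ℝ) - 1) / q * (1 - d))) * Real.log q ≤
      ((q : ℝ) - 1) * d ^ s - Real.log q := by
  have hq' : (2 : ℝ) ≤ q := by exact_mod_cast hq
  have hq0 : (0 : ℝ) < q := by linarith
  have hq1 : (0 : ℝ) < q - 1 := by linarith
  have hlog : 0 < Real.log q := Real.log_pos (by linarith)
  have hx : 1 - (q : ℝ) * (((q : ℝ) - 1) / q * (1 - d)) / ((q : ℝ) - 1) = d := by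
    field_simp
    ring
  have hpos : 0 < 1 + ((q : ℝ) - 1) * d ^ s := by positivity
  rw [Real.logb, div_mul_cancel₀ _ hlog.ne', Zfun, hx, Real.log_div hpos.ne' hq0.ne']
  linarith [Real.log_le_sub_one_of_pos hpos]

/-- **Claim 5.11.** There exists `λ ∈ (0,(q−1)/q)` with
`φ(λ)/h_q(λ) < −1`. -/
theorem phi_div_entropy_lt_neg_one_somewhere
    (q : ℕ) (F : Type) [Field F] [Fintype F] [DecidableEq F]
    (hcard : Fintype.card F = q) (s : ℕ) (hs : 3 ≤ s) :
    ∃ lam ∈ Set.Ioo (0 : ℝ) (((q : ℝ) - 1) / q),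
      phiFun q s lam / qEntropy q lam < -1 := by
  have hq : 2 ≤ q := hcard ▸ Fintype.one_lt_card
  have hq' : (2 : ℝ) ≤ q := by exact_mod_cast hq
  have hq0 : (0 : ℝ) < q := by linarith
  have hq1 : (0 : ℝ) < q - 1 := by linarith
  have hlog : 0 < Real.log q := Real.log_pos (by linarith)
  obtain ⟨d, hd0, hdq, hd1⟩ : ∃ d : ℝ, 0 < d ∧ d * (8 * q) = 1 ∧ d < 1 :=
    ⟨1 / (8 * q), by positivity, by field_simp, by
      rw [div_lt_one (by positivity)]; linarith⟩
  have hl0 : 0 < ((q : ℝ) - 1) / q * (1 - d) := mul_pos (by positivity) (sub_pos.2 hd1)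
  have hl : ((q : ℝ) - 1) / q * (1 - d) < ((q : ℝ) - 1) / q :=
    mul_lt_of_lt_one_right (by positivity) (by linarith)
  have hl1 : ((q : ℝ) - 1) / q * (1 - d) < 1 :=
    hl.trans (by rw [div_lt_one hq0]; linarith)
  refine ⟨_, ⟨hl0, hl⟩, ?_⟩
  rw [div_lt_iff₀ (qEntropy_pos hq hl0 hl1), neg_one_mul]
  refine (phiFun_le_logb_Zfun hq s hl0 hl.le).trans_lt ?_
  refine lt_of_mul_lt_mul_right ?_ hlog.le
  have hZ := logb_Zfun_mul_log_le hq s hd0.le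
  have hH := qEntropy_mul_log_le hq hd0.le hd1
  have hpow : ((q : ℝ) - 1) * d ^ s ≤ (q - 1) * d ^ 3 :=
    mul_le_mul_of_nonneg_left (pow_le_pow_of_le_one hd0.le hd1.le hs) hq1.le
  have hcube : ((q : ℝ) - 1) * d ^ 3 < ((q : ℝ) - 1) / q * (d ^ 2 / 4) := by
    have e : ((q : ℝ) - 1) / q * (d ^ 2 / 4) = 2 * (((q : ℝ) - 1) * d ^ 3) := by
      field_simp
      linear_combination -hdq
    have : 0 < ((q : ℝ) - 1) * d ^ 3 := by positivity
    linarith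
  linarith
end
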